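/- arXiv:1912.03037 — 3 statements merged into one kernel-verified Lean document; each statement's English description precedes it below -/
import Mathlib

section
/- Let l, w, n be natural numbers with 1 ≤ l, 1 ≤ w, and l + w + 2 ≤ n. Set M = max{(l+1)^{l+1} (n−l−1)^{n−l−1}, (w+1)^{w+1} (n−w−1)^{n−w−1}}. Let (N_k)_{k=0}^{n} and (M_k)_{k=0}^{n} be real numbers such that N_k = M_k for every k ∉ {l+1, l+2, …, n−w−1}, and suppose there is a real number D ≥ 0 with |N_k − M_k| ≤ D for every k ∈ {l+1, …, n−w−1}. Define h(p) = ∑_{k=0}^{n} N_k p^k (1−p)^{n−k} and h̃(p) = ∑_{k=0}^{n} M_k p^k (1−p)^{n−k}. Then for every p ∈ [0,1], |h(p) − h̃(p)| ≤ (n−w−l−1) · M · D / n^n. -/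
open Finset

lemma pow_le_exp_aux (a : ℕ) (ha : 0 < a) (x : ℝ) (hx : 0 ≤ x) :
    x ^ a ≤ (a : ℝ) ^ a * Real.exp (x - a) := by
  have ha' : (0 : ℝ) < a := by exact_mod_cast ha
  have h1 : x / a ≤ Real.exp (x / a - 1) := by
    have := Real.add_one_le_exp (x / a - 1)
    linarith
  have h2 : (x / a) ^ a ≤ Real.exp (x / a - 1) ^ a :=
    pow_le_pow_left₀ (by positivity) h1 a
  rw [← Real.exp_nat_mul, div_pow, div_le_iff₀ (by positivity)] at h2
  have h3 : (a : ℝ) * (x / a - 1) = x - a := by field_simp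
  rw [h3] at h2
  linarith

lemma gibbs_aux (a b : ℕ) (ha : 0 < a) (hb : 0 < b) (p : ℝ) (h0 : 0 ≤ p) (h1 : p ≤ 1) :
    p ^ a * (1 - p) ^ b ≤ ((a ^ a * b ^ b : ℕ) : ℝ) / ((a + b : ℕ) : ℝ) ^ (a + b) := by
  have hn : (0 : ℝ) < ((a + b : ℕ) : ℝ) := by exact_mod_cast (by omega : 0 < a + b)
  have hq : 0 ≤ 1 - p := by linarith
  set n : ℝ := ((a + b : ℕ) : ℝ) with hnd
  have e1 := pow_le_exp_aux a ha (p * n) (by positivity)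
  have e2 := pow_le_exp_aux b hb ((1 - p) * n) (by positivity)
  rw [le_div_iff₀ (by positivity)]
  have e3 := mul_le_mul e1 e2 (by positivity) (by positivity)
  have e4 : Real.exp (p * n - a) * Real.exp ((1 - p) * n - b) = 1 := by
    rw [← Real.exp_add, Real.exp_eq_one_iff, hnd]
    push_cast
    ring
  calc p ^ a * (1 - p) ^ b * n ^ (a + b) = (p * n) ^ a * ((1 - p) * n) ^ b := by
        rw [mul_pow, mul_pow, pow_add]; ring
    _ ≤ _ := e3
    _ = (a : ℝ) ^ a * (b : ℝ) ^ b * (Real.exp (p * n - a) * Real.exp ((1 - p) * n - b)) := by ring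
    _ = _ := by rw [e4]; push_cast; ring

lemma shift_aux (x y : ℝ) (hx : 0 ≤ x) (hxy : x ≤ y) (a b d : ℕ) :
    x ^ (a + d) * y ^ b ≤ x ^ a * y ^ (b + d) := by
  have hy : 0 ≤ y := hx.trans hxy
  have h := pow_le_pow_left₀ hx hxy d
  calc x ^ (a + d) * y ^ b = x ^ a * y ^ b * x ^ d := by ring
    _ ≤ x ^ a * y ^ b * y ^ d := by gcongr
    _ = _ := by ring

lemma term_aux (l w n k : ℕ) (hn : l + w + 2 ≤ n) (hk1 : l + 1 ≤ k) (hk2 : k ≤ n - w - 1)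
    (p : ℝ) (h0 : 0 ≤ p) (h1 : p ≤ 1) :
    p ^ k * (1 - p) ^ (n - k) ≤
      ((max ((l+1)^(l+1) * (n-l-1)^(n-l-1)) ((w+1)^(w+1) * (n-w-1)^(n-w-1)) : ℕ) : ℝ)
        / (n : ℝ) ^ n := by
  rcases le_total p (1 - p) with h | h
  · have s := shift_aux p (1 - p) h0 h (l + 1) (n - k) (k - (l + 1))
    have g := gibbs_aux (l + 1) (n - l - 1) (by omega) (by omega) p h0 h1
    rw [show l + 1 + (k - (l + 1)) = k by omega,
      show n - k + (k - (l + 1)) = n - l - 1 by omega] at s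
    rw [show l + 1 + (n - l - 1) = n by omega] at g
    refine s.trans (g.trans ?_)
    gcongr
    exact le_max_left _ _
  · have s := shift_aux (1 - p) p (by linarith) h (w + 1) k (n - k - (w + 1))
    have g := gibbs_aux (n - w - 1) (w + 1) (by omega) (by omega) p h0 h1
    rw [show w + 1 + (n - k - (w + 1)) = n - k by omega,
      show k + (n - k - (w + 1)) = n - w - 1 by omega] at s
    rw [show n - w - 1 + (w + 1) = n by omega] at g
    rw [mul_comm, mul_comm ((1 - p) ^ _)] at s
    refine s.trans (g.trans ?_)
    gcongr
    rw [mul_comm]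
    exact le_max_right _ _

theorem bernstein_approx_error (l w n : ℕ) (hl : 1 ≤ l) (hw : 1 ≤ w)
    (hn : l + w + 2 ≤ n) (N M : ℕ → ℝ) (D : ℝ) (hD : 0 ≤ D)
    (hout : ∀ k ≤ n, (k < l + 1 ∨ n - w - 1 < k) → N k = M k)
    (hin : ∀ k, l + 1 ≤ k → k ≤ n - w - 1 → |N k - M k| ≤ D) :
    ∀ p ∈ Set.Icc (0:ℝ) 1,
      |(∑ k ∈ Finset.range (n+1), N k * p ^ k * (1 - p) ^ (n - k)) -
        (∑ k ∈ Finset.range (n+1), M k * p ^ k * (1 - p) ^ (n - k))| ≤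
      ((n - w - l - 1 : ℕ) : ℝ) *
        ((max ((l+1)^(l+1) * (n-l-1)^(n-l-1)) ((w+1)^(w+1) * (n-w-1)^(n-w-1)) : ℕ) : ℝ) *
        D / (n : ℝ) ^ n := by
  rintro p ⟨h0, h1⟩
  have hq : 0 ≤ 1 - p := by linarith
  have key := fun k hk1 hk2 => term_aux l w n k hn hk1 hk2 p h0 h1
  set X : ℝ :=
    ((max ((l+1)^(l+1) * (n-l-1)^(n-l-1)) ((w+1)^(w+1) * (n-w-1)^(n-w-1)) : ℕ) : ℝ)
  rw [← Finset.sum_sub_distrib]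
  have hsub : Finset.Icc (l + 1) (n - w - 1) ⊆ Finset.range (n + 1) := by
    intro k hk
    simp only [Finset.mem_Icc, Finset.mem_range] at *
    omega
  rw [← Finset.sum_subset hsub]
  · refine (Finset.abs_sum_le_sum_abs _ _).trans ?_
    have hb : ∀ k ∈ Finset.Icc (l + 1) (n - w - 1),
        |N k * p ^ k * (1 - p) ^ (n - k) - M k * p ^ k * (1 - p) ^ (n - k)|
          ≤ D * (X / (n : ℝ) ^ n) := by
      intro k hk
      obtain ⟨hk1, hk2⟩ := Finset.mem_Icc.1 hk
      have e : N k * p ^ k * (1 - p) ^ (n - k) - M k * p ^ k * (1 - p) ^ (n - k)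
          = (N k - M k) * (p ^ k * (1 - p) ^ (n - k)) := by ring
      have hp : 0 ≤ p ^ k * (1 - p) ^ (n - k) := by positivity
      rw [e, abs_mul, abs_of_nonneg hp]
      exact mul_le_mul (hin k hk1 hk2) (key k hk1 hk2) hp hD
    refine (Finset.sum_le_card_nsmul _ _ _ hb).trans (le_of_eq ?_)
    rw [Nat.card_Icc, show n - w - 1 + 1 - (l + 1) = n - w - l - 1 by omega, nsmul_eq_mul]
    ring
  · intro k hk hk'
    simp only [Finset.mem_Icc, Finset.mem_range] at *
    rw [hout k (by omega) (by omega), sub_self]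
end

section
/- Let l, w, n be natural numbers with 1 ≤ l, 1 ≤ w, l + w + 2 ≤ n, and set M = max{(l+1)^{l+1} (n−l−1)^{n−l−1}, (w+1)^{w+1} (n−w−1)^{n−w−1}}. Let (N_k), (M_k), (N⊥_k), (M⊥_k), k = 0,…,n, be real numbers such that: (i) the exact polynomials h(p) = ∑_k N_k p^k (1−p)^{n−k} and h⊥(p) = ∑_k N⊥_k p^k (1−p)^{n−k} satisfy the duality identity h(p) + h⊥(1−p) = 1 for all p ∈ [0,1]; (ii) N_k = M_k for k ∉ {l+1,…,n−w−1} and |N_k − M_k| ≤ D on that range; (iii) N⊥_k = M⊥_k for k ∉ {w+1,…,n−l−1} and |N⊥_k − M⊥_k| ≤ D on that range, for some D ≥ 0. Define h̃(p) = ∑_k M_k p^k (1−p)^{n−k} and h̃⊥(p) = ∑_k M⊥_k p^k (1−p)^{n−k}. Then for every p ∈ [0,1], |1 − h̃(p) − h̃⊥(1−p)| ≤ 2 (n−w−l−1) · M · D / n^n. -/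
open Finset

lemma aux_gibbs (k m : ℕ) (hk : 0 < k) (hm : 0 < m) (p q : ℝ) (hp : 0 ≤ p) (hq : 0 ≤ q)
    (hpq : p + q = 1) :
    p ^ k * q ^ m * ((k + m : ℕ) : ℝ) ^ (k + m) ≤ (k : ℝ) ^ k * (m : ℝ) ^ m := by
  have hk' : (0 : ℝ) < k := by exact_mod_cast hk
  have hm' : (0 : ℝ) < m := by exact_mod_cast hm
  set c : ℝ := ((k + m : ℕ) : ℝ) with hc
  have hc' : c = k + m := by rw [hc]; push_cast; ring
  have hc0 : 0 ≤ c := by rw [hc']; positivity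
  have h1 : (p * c / k) ^ k ≤ Real.exp (p * c - k) := by
    have h : p * c / k ≤ Real.exp (p * c / k - 1) := by
      have := Real.add_one_le_exp (p * c / k - 1); linarith
    calc (p * c / k) ^ k ≤ (Real.exp (p * c / k - 1)) ^ k := by gcongr
      _ = Real.exp (p * c - k) := by
        rw [← Real.exp_nat_mul]; congr 1; field_simp
  have h2 : (q * c / m) ^ m ≤ Real.exp (q * c - m) := by
    have h : q * c / m ≤ Real.exp (q * c / m - 1) := by
      have := Real.add_one_le_exp (q * c / m - 1); linarith
    calc (q * c / m) ^ m ≤ (Real.exp (q * c / m - 1)) ^ m := by gcongr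
      _ = Real.exp (q * c - m) := by
        rw [← Real.exp_nat_mul]; congr 1; field_simp
  have h3 : (p * c / k) ^ k * (q * c / m) ^ m ≤ 1 := by
    calc _ ≤ Real.exp (p * c - k) * Real.exp (q * c - m) := by gcongr
      _ = 1 := by
        rw [← Real.exp_add, Real.exp_eq_one_iff]
        linear_combination c * hpq + hc'
  rw [div_pow, div_pow, div_mul_div_comm, div_le_one (by positivity)] at h3
  calc _ = (p * c) ^ k * (q * c) ^ m := by rw [mul_pow, mul_pow, pow_add]; ring
    _ ≤ _ := h3

lemma aux_shift (a k n : ℕ) (hak : a ≤ k) (hkn : k ≤ n) (p q : ℝ) (hp : 0 ≤ p)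
    (hpq : p ≤ q) : p ^ k * q ^ (n - k) ≤ p ^ a * q ^ (n - a) := by
  have hq : 0 ≤ q := hp.trans hpq
  obtain ⟨d, rfl⟩ := Nat.exists_eq_add_of_le hak
  have : n - a = d + (n - (a + d)) := by omega
  rw [this, pow_add, pow_add, mul_assoc]
  gcongr

lemma aux_term (a b k n : ℕ) (ha : 0 < a) (hb : 0 < b) (hak : a ≤ k) (hkb : k + b ≤ n)
    (p q : ℝ) (hp : 0 ≤ p) (hq : 0 ≤ q) (hpq : p + q = 1) :
    p ^ k * q ^ (n - k) ≤
      ((max (a ^ a * (n - a) ^ (n - a)) (b ^ b * (n - b) ^ (n - b)) : ℕ) : ℝ) / (n : ℝ) ^ n := by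
  have hn : (0 : ℝ) < n := by
    have : 0 < n := by omega
    exact_mod_cast this
  rw [le_div_iff₀ (by positivity), Nat.cast_max]
  rcases le_total p q with h | h
  · refine le_trans ?_ (le_max_left _ _)
    have h1 := aux_shift a k n hak (by omega) p q hp h
    have h2 := aux_gibbs a (n - a) ha (by omega) p q hp hq hpq
    rw [show a + (n - a) = n by omega] at h2
    push_cast
    exact (mul_le_mul_of_nonneg_right h1 (by positivity)).trans h2
  · refine le_trans ?_ (le_max_right _ _)
    have h1 := aux_shift b (n - k) n (by omega) (by omega) q p hq h
    have h2 := aux_gibbs b (n - b) hb (by omega) q p hq hp (by linarith)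
    rw [show b + (n - b) = n by omega] at h2
    rw [show n - (n - k) = k by omega, mul_comm (q ^ _)] at h1
    push_cast
    exact (mul_le_mul_of_nonneg_right h1 (by positivity)).trans h2

lemma aux_sum (a b n : ℕ) (ha : 0 < a) (hb : 0 < b) (hab : a + b ≤ n) (N M : ℕ → ℝ) (D : ℝ)
    (hout : ∀ k ≤ n, (k < a ∨ n - b < k) → N k = M k)
    (hin : ∀ k, a ≤ k → k ≤ n - b → |N k - M k| ≤ D)
    (p q : ℝ) (hp : 0 ≤ p) (hq : 0 ≤ q) (hpq : p + q = 1) :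
    |∑ k ∈ Finset.range (n+1), N k * p ^ k * q ^ (n - k) -
      ∑ k ∈ Finset.range (n+1), M k * p ^ k * q ^ (n - k)| ≤
      ((n - b + 1 - a : ℕ) : ℝ) * (D *
      (((max (a ^ a * (n - a) ^ (n - a)) (b ^ b * (n - b) ^ (n - b)) : ℕ) : ℝ)
        / (n : ℝ) ^ n)) := by
  rw [← Finset.sum_sub_distrib]
  have hs : Finset.Icc a (n - b) ⊆ Finset.range (n + 1) := by
    intro k hk
    rw [Finset.mem_Icc] at hk
    rw [Finset.mem_range]
    omega
  rw [← Finset.sum_subset hs]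
  · rw [← Nat.card_Icc, ← nsmul_eq_mul]
    refine (Finset.abs_sum_le_sum_abs _ _).trans (Finset.sum_le_card_nsmul _ _ _ ?_)
    intro k hk
    rw [Finset.mem_Icc] at hk
    have h1 := hin k hk.1 hk.2
    have h2 := aux_term a b k n ha hb hk.1 (by omega) p q hp hq hpq
    have h0 : 0 ≤ p ^ k * q ^ (n - k) := by positivity
    rw [show N k * p ^ k * q ^ (n - k) - M k * p ^ k * q ^ (n - k)
      = (N k - M k) * (p ^ k * q ^ (n - k)) by ring, abs_mul, abs_of_nonneg h0]
    exact mul_le_mul h1 h2 h0 ((abs_nonneg _).trans h1)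
  · intro k hk hk'
    rw [Finset.mem_range] at hk
    rw [Finset.mem_Icc] at hk'
    rw [hout k (by omega) (by omega)]
    ring



theorem bernstein_approx_cumulative_error (l w n : ℕ) (hl : 1 ≤ l) (hw : 1 ≤ w)
    (hn : l + w + 2 ≤ n) (N M Nd Md : ℕ → ℝ) (D : ℝ) (hD : 0 ≤ D)
    (hdual : ∀ p ∈ Set.Icc (0:ℝ) 1,
      (∑ k ∈ Finset.range (n+1), N k * p ^ k * (1 - p) ^ (n - k)) +
      (∑ k ∈ Finset.range (n+1), Nd k * (1 - p) ^ k * p ^ (n - k)) = 1)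
    (hout : ∀ k ≤ n, (k < l + 1 ∨ n - w - 1 < k) → N k = M k)
    (hin : ∀ k, l + 1 ≤ k → k ≤ n - w - 1 → |N k - M k| ≤ D)
    (houtd : ∀ k ≤ n, (k < w + 1 ∨ n - l - 1 < k) → Nd k = Md k)
    (hind : ∀ k, w + 1 ≤ k → k ≤ n - l - 1 → |Nd k - Md k| ≤ D) :
    ∀ p ∈ Set.Icc (0:ℝ) 1,
      |1 - (∑ k ∈ Finset.range (n+1), M k * p ^ k * (1 - p) ^ (n - k)) -
        (∑ k ∈ Finset.range (n+1), Md k * (1 - p) ^ k * p ^ (n - k))| ≤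
      2 * ((n - w - l - 1 : ℕ) : ℝ) *
        ((max ((l+1)^(l+1) * (n-l-1)^(n-l-1)) ((w+1)^(w+1) * (n-w-1)^(n-w-1)) : ℕ) : ℝ) *
        D / (n : ℝ) ^ n := by

  intro p hp
  have hp0 : 0 ≤ p := hp.1
  have hq0 : 0 ≤ 1 - p := by linarith [hp.2]
  have h1 := aux_sum (l+1) (w+1) n (by omega) (by omega) (by omega) N M D
    (fun k hk h => hout k hk (by omega)) (fun k h h' => hin k h (by omega)) p (1 - p) hp0 hq0
    (by ring)
  have h2 := aux_sum (w+1) (l+1) n (by omega) (by omega) (by omega) Nd Md D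
    (fun k hk h => houtd k hk (by omega)) (fun k h h' => hind k h (by omega)) (1 - p) p hq0 hp0
    (by ring)
  have h3 := hdual p hp
  rw [max_comm] at h2
  rw [show n - (l+1) + 1 - (w+1) = n - w - l - 1 by omega] at h2
  rw [show n - (w+1) + 1 - (l+1) = n - w - l - 1 by omega] at h1
  simp only [← Nat.sub_sub n l 1, ← Nat.sub_sub n w 1] at h1 h2
  refine le_trans (le_of_eq ?_) ((abs_add_le _ _).trans ((add_le_add h1 h2).trans (le_of_eq ?_)))
  · congr 1; linear_combination -h3
  · ring
end

section
/- Let n ≥ 1 be a natural number and let (N_k)_{k=0}^{n} and (N⊥_k)_{k=0}^{n} be real numbers with N_0 = N⊥_0 = 0 and N_n = N⊥_n = 1, such that the polynomials h(p) = ∑_{k=0}^{n} N_k p^k (1−p)^{n−k} and h⊥(p) = ∑_{k=0}^{n} N⊥_k p^k (1−p)^{n−k} satisfy h(p) + h⊥(1−p) = 1 for all p ∈ [0,1]. Let F and F⊥ be the piecewise linear interpolants on [0,n] of the points (k, N_k) and (k, N⊥_k) respectively. Then ∫_0^n F(x) dx + ∫_0^n F⊥(x) dx = 2^n − 1. -/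
open Finset intervalIntegral

/-- The integral of the interpolant over `[0,m]`, by the trapezoid rule. -/
theorem interp_integral (n : ℕ) (N : ℕ → ℝ) (F : ℝ → ℝ)
    (hF : ∀ k ∈ Finset.Icc 1 n, ∀ x ∈ Set.Icc ((k:ℝ) - 1) (k:ℝ),
      F x = (N k - N (k-1)) * x + (k:ℝ) * N (k-1) - ((k:ℝ) - 1) * N k) :
    (∫ x in (0:ℝ)..(n:ℝ), F x) = (∑ k ∈ Finset.range (n+1), N k) - (N 0 + N n) / 2 := by
  have key : ∀ k < n, Set.EqOn (fun x : ℝ => (N (k+1) - N k) * x + (((k:ℝ)+1) * N k - (k:ℝ) * N (k+1)))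
      F (Set.uIcc ((k:ℕ):ℝ) ((k+1:ℕ):ℝ)) := by
    intro k hk x hx
    rw [Set.uIcc_of_le (by push_cast; linarith)] at hx
    have h := hF (k+1) (by simp; omega) x (by
      push_cast at hx ⊢
      exact ⟨by linarith [hx.1], hx.2⟩)
    rw [h]
    simp only [Nat.add_sub_cancel]
    push_cast
    ring
  have hint : ∀ k < n, IntervalIntegrable F MeasureTheory.volume ((k:ℕ):ℝ) ((k+1:ℕ):ℝ) := by
    intro k hk
    have hc : ContinuousOn F (Set.uIcc ((k:ℕ):ℝ) ((k+1:ℕ):ℝ)) :=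
      ContinuousOn.congr (by fun_prop) (key k hk).symm
    exact hc.intervalIntegrable
  have hval : ∀ k < n, (∫ x in ((k:ℕ):ℝ)..((k+1:ℕ):ℝ), F x) = (N k + N (k+1)) / 2 := by
    intro k hk
    rw [← intervalIntegral.integral_congr (key k hk),
      intervalIntegral.integral_add (Continuous.intervalIntegrable (by fun_prop) _ _)
        (Continuous.intervalIntegrable (by fun_prop) _ _),
      intervalIntegral.integral_const_mul, integral_id, intervalIntegral.integral_const]
    simp only [smul_eq_mul]
    push_cast
    ring
  have hs := intervalIntegral.sum_integral_adjacent_intervals (a := fun k : ℕ => (k:ℝ)) hint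
  simp only [Nat.cast_zero] at hs
  rw [← hs, Finset.sum_congr rfl (fun k hk => hval k (Finset.mem_range.mp hk)),
    ← Finset.sum_div, Finset.sum_add_distrib]
  have h1 := Finset.sum_range_succ N n
  have h2 := Finset.sum_range_succ' N n
  linarith

theorem dual_coeff_functions_integral_complementary (n : ℕ) (hn : 1 ≤ n)
    (N Nd : ℕ → ℝ) (hN0 : N 0 = 0) (hNd0 : Nd 0 = 0) (hNn : N n = 1) (hNdn : Nd n = 1)
    (hdual : ∀ p ∈ Set.Icc (0:ℝ) 1,
      (∑ k ∈ Finset.range (n+1), N k * p ^ k * (1 - p) ^ (n - k)) +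
      (∑ k ∈ Finset.range (n+1), Nd k * (1 - p) ^ k * p ^ (n - k)) = 1)
    (F Fd : ℝ → ℝ)
    (hF : ∀ k ∈ Finset.Icc 1 n, ∀ x ∈ Set.Icc ((k:ℝ) - 1) (k:ℝ),
      F x = (N k - N (k-1)) * x + (k:ℝ) * N (k-1) - ((k:ℝ) - 1) * N k)
    (hFd : ∀ k ∈ Finset.Icc 1 n, ∀ x ∈ Set.Icc ((k:ℝ) - 1) (k:ℝ),
      Fd x = (Nd k - Nd (k-1)) * x + (k:ℝ) * Nd (k-1) - ((k:ℝ) - 1) * Nd k) :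
    (∫ x in (0:ℝ)..(n:ℝ), F x) + (∫ x in (0:ℝ)..(n:ℝ), Fd x) = 2 ^ n - 1 := by
  rw [interp_integral n N F hF, interp_integral n Nd Fd hFd, hN0, hNd0, hNn, hNdn]
  have h := hdual (1/2) ⟨by norm_num, by norm_num⟩
  have hh : ∀ M : ℕ → ℝ, ∀ k ∈ Finset.range (n+1),
      M k * (1/2:ℝ) ^ k * (1/2) ^ (n - k) = M k * (1/2) ^ n := by
    intro M k hk
    rw [mul_assoc, ← pow_add, Nat.add_sub_cancel' (by simp at hk; omega)]
  rw [show (1 - 1/2 : ℝ) = 1/2 by norm_num, Finset.sum_congr rfl (hh N),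
    Finset.sum_congr rfl (hh Nd), ← Finset.sum_mul, ← Finset.sum_mul, ← add_mul,
    one_div, inv_pow] at h
  have h2 := (mul_inv_eq_one₀ (by positivity)).mp h
  linarith
end
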